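/- Let x̂ ∈ D, set P̂ := P_c(x̂), and let P̃ belong to the topological interior of the convex hull of F. Then there exists a unique continuously differentiable path γ : [0,1] → ℝⁿ such that γ(θ) ∈ D for all θ ∈ [0,1], γ(0) = x̂, and γ′(θ) = J(γ(θ))⁻¹ (P̃ − P̂) for all θ ∈ [0,1]. This path satisfies P_c(γ(θ)) = θ P̃ + (1 − θ) P̂ for all θ ∈ [0,1]; in particular P̃ = P_c(γ(1)). -/

import Mathlib

open Matrix Set

noncomputable section

/-- `A` is irreducible: for every nonempty proper subset `α` of the index set,
the submatrix `A[α, αᶜ]` is not the zero matrix. -/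
def IsIrred {k : ℕ} (A : Matrix (Fin k) (Fin k) ℝ) : Prop :=
  ∀ α : Finset (Fin k), α.Nonempty → α ≠ Finset.univ → ∃ i ∈ α, ∃ j ∈ αᶜ, A i j ≠ 0

/-- `A` is a Z-matrix: off-diagonal entries are nonpositive. -/
def IsZmat {k : ℕ} (A : Matrix (Fin k) (Fin k) ℝ) : Prop :=
  ∀ i j, i ≠ j → A i j ≤ 0

/-- `A` is an M-matrix: a Z-matrix all of whose eigenvalues have nonnegative real part. -/
def IsMmat {k : ℕ} (A : Matrix (Fin k) (Fin k) ℝ) : Prop :=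
  IsZmat A ∧ ∀ μ ∈ spectrum ℂ (A.map (Complex.ofReal)), 0 ≤ μ.re

/-- `A` is a nonsingular M-matrix: a Z-matrix all of whose eigenvalues have positive real part. -/
def IsNonsingMmat {k : ℕ} (A : Matrix (Fin k) (Fin k) ℝ) : Prop :=
  IsZmat A ∧ ∀ μ ∈ spectrum ℂ (A.map (Complex.ofReal)), 0 < μ.re

/-- `P_c(x) = [x] Y (V* − x)`. -/
def Pc {k : ℕ} (Y : Matrix (Fin k) (Fin k) ℝ) (Vs : Fin k → ℝ) (x : Fin k → ℝ) : Fin k → ℝ :=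
  Matrix.diagonal x *ᵥ (Y *ᵥ (Vs - x))

/-- Jacobian of `P_c` at `x`: `J(x) = [Y(V* − x)] − [x] Y`. -/
def Jmat {k : ℕ} (Y : Matrix (Fin k) (Fin k) ℝ) (Vs : Fin k → ℝ) (x : Fin k → ℝ) :
    Matrix (Fin k) (Fin k) ℝ :=
  Matrix.diagonal (Y *ᵥ (Vs - x)) - Matrix.diagonal x * Y

/-- long-term voltage stable operating points. -/
def Dset {k : ℕ} (Y : Matrix (Fin k) (Fin k) ℝ) (Vs : Fin k → ℝ) : Set (Fin k → ℝ) :=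
  {x | (∀ i, 0 < x i) ∧ IsUnit (Jmat Y Vs x).det ∧ ∀ i j, (Jmat Y Vs x)⁻¹ i j < 0}

/-- feasible power demands. -/
def Fset {k : ℕ} (Y : Matrix (Fin k) (Fin k) ℝ) (Vs : Fin k → ℝ) : Set (Fin k → ℝ) :=
  {P | ∃ x, (∀ i, 0 < x i) ∧ Pc Y Vs x = P}

/-- `h(λ) = (1/2)([λ] Y + Y [λ])`. -/
def hmat {k : ℕ} (Y : Matrix (Fin k) (Fin k) ℝ) (l : Fin k → ℝ) : Matrix (Fin k) (Fin k) ℝ :=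
  (1/2 : ℝ) • (Matrix.diagonal l * Y + Y * Matrix.diagonal l)

/-- `Λ₁ = {λ ∈ Λ : λ > 0, 1ᵀλ = 1}`. -/
def Lam1 {k : ℕ} (Y : Matrix (Fin k) (Fin k) ℝ) : Set (Fin k → ℝ) :=
  {l | (hmat Y l).PosDef ∧ (∀ i, 0 < l i) ∧ ∑ i, l i = 1}

/-- `φ(λ) = (1/2) h(λ)⁻¹ [λ] I*` where `I* = Y V*`. -/
def phiv {k : ℕ} (Y : Matrix (Fin k) (Fin k) ℝ) (Vs : Fin k → ℝ) (l : Fin k → ℝ) : Fin k → ℝ :=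
  (1/2 : ℝ) • ((hmat Y l)⁻¹ *ᵥ (Matrix.diagonal l *ᵥ (Y *ᵥ Vs)))

/-- `‖x‖_{h(λ)}²  = xᵀ h(λ) x`. -/
def qnorm {k : ℕ} (Y : Matrix (Fin k) (Fin k) ℝ) (l x : Fin k → ℝ) : ℝ :=
  x ⬝ᵥ (hmat Y l *ᵥ x)

/-- The half-space `H_λ`. -/
def Hset {k : ℕ} (Y : Matrix (Fin k) (Fin k) ℝ) (Vs : Fin k → ℝ) (l : Fin k → ℝ) :
    Set (Fin k → ℝ) :=
  {y | l ⬝ᵥ y ≤ qnorm Y l (phiv Y Vs l)}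


/-- A continuously differentiable path in `D` starting at `xh` solving
`γ′(θ) = J(γ(θ))⁻¹ (P̃ − P̂)` on `[0,1]`. -/
def PathProp {k : ℕ} (Y : Matrix (Fin k) (Fin k) ℝ) (Vs : Fin k → ℝ)
    (Ph Pt : Fin k → ℝ) (xh : Fin k → ℝ) (γ : ℝ → Fin k → ℝ) : Prop :=
  ContDiffOn ℝ 1 γ (Icc 0 1) ∧
  γ 0 = xh ∧
  (∀ θ ∈ Icc (0 : ℝ) 1, γ θ ∈ Dset Y Vs) ∧
  (∀ θ ∈ Icc (0 : ℝ) 1,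
    HasDerivWithinAt γ ((Jmat Y Vs (γ θ))⁻¹ *ᵥ (Pt - Ph)) (Icc 0 1) θ)

theorem aux_pos {n : ℕ} (B : Matrix (Fin n) (Fin n) ℝ) (hZ : IsZmat B) (hI : IsIrred B)
    (v : Fin n → ℝ) (hv : ∀ i, 0 ≤ v i) (hne : ∃ i, v i ≠ 0)
    (hB : ∀ i, v i = 0 → 0 ≤ (B *ᵥ v) i) :
    ∀ i, 0 < v i := by
  by_contra! hcon
  obtain ⟨i0, hi0⟩ := hcon
  obtain ⟨k, hk⟩ := hne
  obtain ⟨i, hi, j, hj, hij⟩ := hI (Finset.univ.filter fun i => v i = 0)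
    ⟨i0, by simpa using le_antisymm hi0 (hv i0)⟩
    (fun h => hk (by have := Finset.mem_univ k; rw [← h] at this; simpa using this))
  simp only [Finset.mem_filter, Finset.mem_univ, true_and, Finset.mem_compl] at hi hj
  have hne : i ≠ j := fun h => hj (h ▸ hi)
  have h1 : (B *ᵥ v) i < 0 := by
    simp only [Matrix.mulVec, dotProduct]
    refine Finset.sum_neg' (fun k _ => ?_) ⟨j, Finset.mem_univ _, ?_⟩
    · by_cases h : i = k
      · subst h; simp [hi]
      · exact mul_nonpos_of_nonpos_of_nonneg (hZ i k h) (hv k)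
    · exact mul_neg_of_neg_of_pos (lt_of_le_of_ne (hZ i j hne) hij)
        (lt_of_le_of_ne (hv j) (Ne.symm hj))
  linarith [hB i hi]

theorem aux_mono {n : ℕ} (B : Matrix (Fin n) (Fin n) ℝ) (hZ : IsZmat B)
    (u : Fin n → ℝ) (hu : ∀ i, 0 < u i) (hBu : ∀ i, 0 < (B *ᵥ u) i)
    (v : Fin n → ℝ) (hB : ∀ i, 0 ≤ (B *ᵥ v) i) : ∀ i, 0 ≤ v i := by
  by_contra! hcon
  obtain ⟨i0, hi0⟩ := hcon
  obtain ⟨i, -, hi⟩ := Finset.exists_min_image Finset.univ (fun i => v i / u i) ⟨i0, by simp⟩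
  set t := v i / u i with ht
  have ht0 : t < 0 := lt_of_le_of_lt (hi i0 (by simp)) (div_neg_of_neg_of_pos hi0 (hu i0))
  have h1 : (B *ᵥ (v - t • u)) i ≤ 0 := by
    simp only [Matrix.mulVec, dotProduct]
    refine Finset.sum_nonpos (fun k _ => ?_)
    by_cases h : i = k
    · subst h
      have : v i - t * u i = 0 := by rw [ht]; field_simp [(hu i).ne']; ring
      simp [this]
    · refine mul_nonpos_of_nonpos_of_nonneg (hZ i k h) ?_
      have := hi k (by simp)
      rw [le_div_iff₀ (hu k)] at this
      simpa using this
  rw [Matrix.mulVec_sub, Matrix.mulVec_smul] at h1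
  simp only [Pi.sub_apply, Pi.smul_apply, smul_eq_mul] at h1
  nlinarith [hB i, hBu i]

theorem aux_inv {n : ℕ} (B : Matrix (Fin n) (Fin n) ℝ) (hZ : IsZmat B) (hI : IsIrred B)
    (u : Fin n → ℝ) (hu : ∀ i, 0 < u i) (hBu : ∀ i, 0 < (B *ᵥ u) i) :
    IsUnit B.det ∧ ∀ i j, 0 < B⁻¹ i j := by
  have hdet : IsUnit B.det := by
    rw [isUnit_iff_ne_zero]
    intro h
    obtain ⟨v, hv, h0⟩ := Matrix.exists_mulVec_eq_zero_iff.2 h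
    apply hv
    funext i
    have h1 := aux_mono B hZ u hu hBu v (by simp [h0]) i
    have h2 := aux_mono B hZ u hu hBu (-v) (by simp [Matrix.mulVec_neg, h0]) i
    simp at h2 ⊢
    linarith
  refine ⟨hdet, fun i j => ?_⟩
  set v : Fin n → ℝ := fun k => B⁻¹ k j with hv
  have hBv : ∀ k, (B *ᵥ v) k = (1 : Matrix (Fin n) (Fin n) ℝ) k j := by
    intro k
    rw [← Matrix.mul_nonsing_inv B hdet, Matrix.mul_apply]; rfl
  have hBv0 : ∀ k, 0 ≤ (B *ᵥ v) k := by
    intro k; rw [hBv, Matrix.one_apply]; split_ifs <;> norm_num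
  refine aux_pos B hZ hI v (aux_mono B hZ u hu hBu v hBv0) ?_ (fun k _ => hBv0 k) i
  by_contra! h
  have : v = 0 := funext h
  have h2 := hBv j
  simp [this] at h2

/-- minus the transposed Jacobian -/
def Bm {k : ℕ} (Y : Matrix (Fin k) (Fin k) ℝ) (Vs : Fin k → ℝ) (x : Fin k → ℝ) :
    Matrix (Fin k) (Fin k) ℝ := -(Jmat Y Vs x)ᵀ

theorem Jmat_apply {n : ℕ} (Y : Matrix (Fin n) (Fin n) ℝ) (Vs x : Fin n → ℝ) (i j : Fin n) :
    Jmat Y Vs x i j = (if i = j then (Y *ᵥ (Vs - x)) i else 0) - x i * Y i j := by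
  simp [Jmat, Matrix.diagonal_apply, Matrix.diagonal_mul]

theorem Bm_apply {n : ℕ} (Y : Matrix (Fin n) (Fin n) ℝ) (Vs x : Fin n → ℝ) (i j : Fin n) :
    Bm Y Vs x i j = x j * Y j i - (if i = j then (Y *ᵥ (Vs - x)) i else 0) := by
  simp only [Bm, Matrix.neg_apply, Matrix.transpose_apply, Jmat_apply]
  by_cases h : i = j
  · subst h; simp
  · simp [h, Ne.symm h]

theorem Pc_apply {n : ℕ} (Y : Matrix (Fin n) (Fin n) ℝ) (Vs x : Fin n → ℝ) (i : Fin n) :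
    Pc Y Vs x i = x i * (Y *ᵥ (Vs - x)) i := by
  simp [Pc, Matrix.mulVec_diagonal]

theorem Bm_Z {n : ℕ} {Y : Matrix (Fin n) (Fin n) ℝ} (hZ : IsZmat Y) (Vs x : Fin n → ℝ)
    (hx : ∀ i, 0 ≤ x i) : IsZmat (Bm Y Vs x) := by
  intro i j hij
  rw [Bm_apply]; simp [hij]
  exact mul_nonpos_of_nonneg_of_nonpos (hx j) (hZ j i (Ne.symm hij))

theorem Bm_irr {n : ℕ} {Y : Matrix (Fin n) (Fin n) ℝ} (hs : ∀ i j, Y i j = Y j i)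
    (hI : IsIrred Y) (Vs x : Fin n → ℝ)
    (hx : ∀ i, 0 < x i) : IsIrred (Bm Y Vs x) := by
  intro α h1 h2
  obtain ⟨i, hi, j, hj, h⟩ := hI α h1 h2
  refine ⟨i, hi, j, hj, ?_⟩
  have hij : i ≠ j := fun h => by subst h; simp at hj; exact hj hi
  rw [Bm_apply]; simp [hij]
  exact ⟨(hx j).ne', by rwa [hs j i]⟩

theorem Bm_mulVec {n : ℕ} (Y : Matrix (Fin n) (Fin n) ℝ) (Vs x u : Fin n → ℝ) (i : Fin n) :
    (Bm Y Vs x *ᵥ u) i = (∑ j, Y j i * (u j * x j)) + u i * (Y *ᵥ x) i - u i * (Y *ᵥ Vs) i := by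
  simp only [Matrix.mulVec, dotProduct, Bm_apply, sub_mul, Finset.sum_sub_distrib, ite_mul,
    zero_mul, Finset.sum_ite_eq, Finset.mem_univ, if_true, Pi.sub_apply, mul_sub]
  have : ∀ j, x j * Y j i * u j = Y j i * (u j * x j) := fun j => by ring
  simp only [this]; ring

/-- normalized certificate -/
theorem D_cert {n : ℕ} {Y : Matrix (Fin n) (Fin n) ℝ} (hn : 1 ≤ n) {Vs x : Fin n → ℝ}
    (h : x ∈ Dset Y Vs) : ∃ u : Fin n → ℝ, (∀ i, 0 < u i) ∧ ∀ i, (Bm Y Vs x *ᵥ u) i = 1 := by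
  obtain ⟨hx, hd, hneg⟩ := h
  refine ⟨fun i => ∑ j, -(Jmat Y Vs x)⁻¹ j i, fun i => ?_, fun i => ?_⟩
  · exact Finset.sum_pos (fun j _ => by linarith [hneg j i]) ⟨⟨0, hn⟩, by simp⟩
  · have h := Matrix.nonsing_inv_mul (Jmat Y Vs x) hd
    simp only [Matrix.mulVec, dotProduct, Bm, Matrix.neg_apply, Matrix.transpose_apply,
      Finset.mul_sum]
    rw [Finset.sum_comm]
    have h2 : ∀ j, ∑ k, -Jmat Y Vs x k i * -(Jmat Y Vs x)⁻¹ j k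
        = (1 : Matrix (Fin n) (Fin n) ℝ) j i := by
      intro j
      rw [← h, Matrix.mul_apply]
      exact Finset.sum_congr rfl fun k _ => by ring
    rw [Finset.sum_congr rfl fun j _ => h2 j]; simp [Matrix.one_apply]

/-- D via certificates -/
theorem mem_D_iff {n : ℕ} {Y : Matrix (Fin n) (Fin n) ℝ} (hn : 1 ≤ n) (hZ : IsZmat Y)
    (hs : ∀ i j, Y i j = Y j i)
    (hI : IsIrred Y) (Vs x : Fin n → ℝ) :
    x ∈ Dset Y Vs ↔ (∀ i, 0 < x i) ∧ ∃ u : Fin n → ℝ, (∀ i, 0 < u i) ∧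
      ∀ i, 0 < (Bm Y Vs x *ᵥ u) i := by
  constructor
  · intro h
    obtain ⟨u, hu, h1⟩ := D_cert hn h
    exact ⟨h.1, u, hu, fun i => by rw [h1]; norm_num⟩
  · rintro ⟨hx, u, hu, hBu⟩
    obtain ⟨hd, hp⟩ := aux_inv _ (Bm_Z hZ Vs x fun i => (hx i).le) (Bm_irr hs hI Vs x hx) u hu hBu
    have hd' : IsUnit (Jmat Y Vs x).det := by
      rw [Bm, Matrix.det_neg, Matrix.det_transpose] at hd
      exact isUnit_of_mul_isUnit_right hd
    refine ⟨hx, hd', fun i j => ?_⟩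
    have h3 : (Bm Y Vs x)⁻¹ = -((Jmat Y Vs x)⁻¹)ᵀ := by
      apply Matrix.inv_eq_right_inv
      rw [Bm, neg_mul_neg, ← Matrix.transpose_mul, Matrix.nonsing_inv_mul _ hd',
        Matrix.transpose_one]
    have := hp j i
    rw [h3] at this
    simpa using this

theorem D_diag {n : ℕ} {Y : Matrix (Fin n) (Fin n) ℝ} (hn : 1 ≤ n) (hZ : IsZmat Y)
    {Vs x : Fin n → ℝ}
    (h : x ∈ Dset Y Vs) (i : Fin n) : 0 ≤ Bm Y Vs x i i := by
  obtain ⟨u, hu, h1⟩ := D_cert hn h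
  by_contra! hc
  have : (Bm Y Vs x *ᵥ u) i ≤ 0 := by
    simp only [Matrix.mulVec, dotProduct]
    refine Finset.sum_nonpos fun j _ => mul_nonpos_of_nonpos_of_nonneg ?_ (hu j).le
    by_cases hij : i = j
    · subst hij; exact hc.le
    · exact Bm_Z hZ Vs x (fun i => (h.1 i).le) i j hij
  linarith [h1 i]

theorem quad {n : ℕ} {Y : Matrix (Fin n) (Fin n) ℝ} (hZ : IsZmat Y)
    (Vs x u d : Fin n → ℝ)
    (hx : ∀ i, 0 < x i) (hu : ∀ i, 0 ≤ u i) :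
    (1/2) * ∑ i, (d i / x i) ^ 2 * x i * ((Bm Y Vs x *ᵥ u) i + u i * (Y *ᵥ Vs) i)
      ≤ ∑ i, u i * (d i * (Y *ᵥ d) i) := by
  set t : Fin n → ℝ := fun i => d i / x i with ht
  have hd : ∀ i, d i = x i * t i := fun i => by rw [ht]; field_simp [(hx i).ne']
  have h1 : ∑ i, u i * (d i * (Y *ᵥ d) i)
      = ∑ i, ∑ j, u i * Y i j * x i * x j * (t i * t j) := by
    refine Finset.sum_congr rfl fun i _ => ?_
    simp only [Matrix.mulVec, dotProduct, Finset.mul_sum]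
    refine Finset.sum_congr rfl fun j _ => ?_
    rw [hd i, hd j]; ring
  have h2 : (1/2) * ∑ i, (t i) ^ 2 * x i * ((Bm Y Vs x *ᵥ u) i + u i * (Y *ᵥ Vs) i)
      = ∑ i, ∑ j, u i * Y i j * x i * x j * ((t i ^ 2 + t j ^ 2) / 2) := by
    have e1 : ∑ i, ∑ j, u i * Y i j * x i * x j * ((t i ^ 2 + t j ^ 2) / 2)
       = ∑ i, ∑ j, u i * Y i j * x i * x j * (t i ^ 2 / 2)
        + ∑ i, ∑ j, u i * Y i j * x i * x j * (t j ^ 2 / 2) := by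
      simp only [← Finset.sum_add_distrib]
      exact Finset.sum_congr rfl fun i _ => Finset.sum_congr rfl fun j _ => by ring
    rw [e1, Finset.sum_comm (f := fun i j => u i * Y i j * x i * x j * (t j ^ 2 / 2)),
      ← Finset.sum_add_distrib, Finset.mul_sum]
    refine Finset.sum_congr rfl fun i _ => ?_
    rw [Bm_mulVec, ← Finset.sum_add_distrib]
    simp only [Matrix.mulVec, dotProduct]
    have : ∀ a b c : ℝ, a + b - c + c = a + b := fun a b c => by ring
    rw [this, Finset.mul_sum, ← Finset.sum_add_distrib, Finset.mul_sum, Finset.mul_sum]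
    refine Finset.sum_congr rfl fun j _ => by ring
  rw [h1, h2]
  refine Finset.sum_le_sum fun i _ => Finset.sum_le_sum fun j _ => ?_
  by_cases hij : i = j
  · subst hij; apply le_of_eq; ring
  · have hc : u i * Y i j * x i * x j ≤ 0 := by
      have := mul_nonneg (mul_nonneg (hu i) (hx i).le) (hx j).le
      nlinarith [hZ i j hij]
    apply mul_le_mul_of_nonpos_left _ hc
    nlinarith [sq_nonneg (t i - t j)]

theorem Pc_diff {n : ℕ} (Y : Matrix (Fin n) (Fin n) ℝ) 
    (Vs x y u : Fin n → ℝ) :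
    ∑ i, u i * Pc Y Vs y i - ∑ i, u i * Pc Y Vs x i =
      - ∑ i, (Bm Y Vs x *ᵥ u) i * (y i - x i)
      - ∑ i, u i * ((y - x) i * (Y *ᵥ (y - x)) i) := by
  have h : ∑ i, (Bm Y Vs x *ᵥ u) i * (y i - x i)
      = ∑ i, u i * (x i * (Y *ᵥ (y - x)) i - (Y *ᵥ (Vs - x)) i * (y i - x i)) := by
    have e : ∀ i, (Bm Y Vs x *ᵥ u) i * (y i - x i) =
      (∑ j, Y j i * (u j * x j) * (y i - x i)) - u i * ((Y *ᵥ (Vs - x)) i * (y i - x i)) := by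
      intro i
      rw [Bm_mulVec, ← Finset.sum_mul, Matrix.mulVec_sub]
      simp only [Pi.sub_apply]; ring
    rw [Finset.sum_congr rfl fun i _ => e i, Finset.sum_sub_distrib, Finset.sum_comm,
      ← Finset.sum_sub_distrib]
    refine Finset.sum_congr rfl fun i _ => ?_
    have e2 : ∑ j, Y i j * (u i * x i) * (y j - x j) = u i * x i * (Y *ᵥ (y - x)) i := by
      simp only [Matrix.mulVec, dotProduct, Finset.mul_sum, Pi.sub_apply]
      exact Finset.sum_congr rfl fun j _ => by ring
    rw [e2]; ring
  rw [h]
  simp only [← Finset.sum_sub_distrib, ← Finset.sum_neg_distrib, Pc_apply]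
  refine Finset.sum_congr rfl fun i _ => ?_
  simp only [Matrix.mulVec_sub, Pi.sub_apply]
  ring

theorem D_inj {n : ℕ} {Y : Matrix (Fin n) (Fin n) ℝ} (hn : 1 ≤ n) (hZ : IsZmat Y)
    {Vs : Fin n → ℝ} (hInn : ∀ i, 0 ≤ (Y *ᵥ Vs) i)
    {x y : Fin n → ℝ} (hx : x ∈ Dset Y Vs) (hy : y ∈ Dset Y Vs) (h : Pc Y Vs x = Pc Y Vs y) :
    x = y := by
  have key : ∀ x y : Fin n → ℝ, x ∈ Dset Y Vs → Pc Y Vs x = Pc Y Vs y → x ≠ y →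
      ∑ i, (y i - x i) < 0 := by
    intro x y hx h hne
    obtain ⟨u, hu, h1⟩ := D_cert hn hx
    have e := Pc_diff Y Vs x y u
    have q := quad hZ Vs x u (y - x) hx.1 fun i => (hu i).le
    simp only [h, sub_self, h1, one_mul] at e q
    have : 0 < ∑ i, ((y - x) i / x i) ^ 2 * x i * (1 + u i * (Y *ᵥ Vs) i) := by
      obtain ⟨k, hk⟩ := Function.ne_iff.1 hne
      have hp : ∀ i, 0 < 1 + u i * (Y *ᵥ Vs) i := fun i => by
        have := mul_nonneg (hu i).le (hInn i); linarith
      refine Finset.sum_pos' (fun i _ => ?_) ⟨k, by simp, ?_⟩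
      · exact mul_nonneg (mul_nonneg (sq_nonneg _) (hx.1 i).le) (hp i).le
      · refine mul_pos (mul_pos (pow_two_pos_of_ne_zero ?_) (hx.1 k)) (hp k)
        exact div_ne_zero (sub_ne_zero.2 (Ne.symm hk)) (hx.1 k).ne'
    linarith
  by_contra hne
  have h1 := key x y hx h hne
  have h2 := key y x hy h.symm (Ne.symm hne)
  simp only [Finset.sum_sub_distrib] at h1 h2
  linarith

theorem cont_Bm {n : ℕ} (Y : Matrix (Fin n) (Fin n) ℝ) (Vs : Fin n → ℝ) (i j : Fin n) :
    Continuous fun x : Fin n → ℝ => Bm Y Vs x i j := by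
  simp only [Bm_apply, Matrix.mulVec, dotProduct, Pi.sub_apply]
  split_ifs <;> fun_prop

theorem cont_BmV {n : ℕ} (Y : Matrix (Fin n) (Fin n) ℝ) (Vs : Fin n → ℝ) (i : Fin n) :
    Continuous fun p : (Fin n → ℝ) × (Fin n → ℝ) => (Bm Y Vs p.1 *ᵥ p.2) i := by
  simp only [Matrix.mulVec, dotProduct]
  refine continuous_finsetSum _ fun j _ => ?_
  exact ((cont_Bm Y Vs i j).comp continuous_fst).mul (by fun_prop)

theorem contDiff_Pc {n : ℕ} (Y : Matrix (Fin n) (Fin n) ℝ) (Vs : Fin n → ℝ) :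
    ContDiff ℝ 1 (Pc Y Vs) := by
  rw [contDiff_pi]
  intro i
  simp only [Pc_apply, Matrix.mulVec, dotProduct, Pi.sub_apply]
  fun_prop

theorem D_open {n : ℕ} {Y : Matrix (Fin n) (Fin n) ℝ} (hn : 1 ≤ n) (hZ : IsZmat Y)
    (hs : ∀ i j, Y i j = Y j i)
    (hI : IsIrred Y) (Vs : Fin n → ℝ) : IsOpen (Dset Y Vs) := by
  have : Dset Y Vs = ⋃ u : {u : Fin n → ℝ // ∀ i, 0 < u i},
      ((⋂ i, {x : Fin n → ℝ | 0 < x i}) ∩ ⋂ i, {x | 0 < (Bm Y Vs x *ᵥ u.1) i}) := by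
    ext x
    rw [mem_D_iff hn hZ hs hI]
    simp
  rw [this]
  refine isOpen_iUnion fun u => IsOpen.inter ?_ ?_
  · exact isOpen_iInter_of_finite fun i => isOpen_lt continuous_const (continuous_apply i)
  · exact isOpen_iInter_of_finite fun i => isOpen_lt continuous_const
      ((cont_BmV Y Vs i).comp (f := fun x => (x, u.1)) (by fun_prop))

theorem hasFDerivAt_Pc {n : ℕ} (Y : Matrix (Fin n) (Fin n) ℝ) (Vs x : Fin n → ℝ) :
    HasFDerivAt (Pc Y Vs) (LinearMap.toContinuousLinearMap (Matrix.toLin' (Jmat Y Vs x))) x := by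
  rw [hasFDerivAt_pi']
  intro i
  have h1 : HasFDerivAt (fun y : Fin n → ℝ => y i) (ContinuousLinearMap.proj (R := ℝ) i) x :=
    (ContinuousLinearMap.proj (R := ℝ) (φ := fun _ : Fin n => ℝ) i).hasFDerivAt
  let L : (Fin n → ℝ) →L[ℝ] (Fin n → ℝ) := LinearMap.toContinuousLinearMap (Matrix.toLin' Y)
  have h2 : HasFDerivAt (fun y : Fin n → ℝ => (Y *ᵥ (Vs - y)) i)
      (-((ContinuousLinearMap.proj (R := ℝ) i).comp L)) x := by
    have h3 := (((ContinuousLinearMap.proj (R := ℝ) (φ := fun _ : Fin n => ℝ) i).comp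
      L).hasFDerivAt (x := x)).const_sub ((Y *ᵥ Vs) i)
    refine h3.congr_of_eventuallyEq (Filter.Eventually.of_forall fun y => ?_)
    simp [L, Matrix.mulVec_sub]
  have h4 := h1.mul h2
  have e : (fun y => Pc Y Vs y i) = fun y : Fin n → ℝ => y i * (Y *ᵥ (Vs - y)) i :=
    funext fun y => Pc_apply Y Vs y i
  rw [e]
  refine HasFDerivAt.congr_fderiv h4 ?_
  refine ContinuousLinearMap.ext fun v => ?_
  simp [L, Jmat, Matrix.sub_mulVec, ← Matrix.mulVec_mulVec, Matrix.mulVec_diagonal]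
  ring

theorem local_inv {n : ℕ} {Y : Matrix (Fin n) (Fin n) ℝ} {Vs x : Fin n → ℝ}
    (hx : x ∈ Dset Y Vs) : ∃ g : (Fin n → ℝ) → (Fin n → ℝ), g (Pc Y Vs x) = x ∧
      ContDiffAt ℝ 1 g (Pc Y Vs x) ∧ (∀ᶠ P in nhds (Pc Y Vs x), Pc Y Vs (g P) = P) ∧
      HasFDerivAt g (LinearMap.toContinuousLinearMap (Matrix.toLin' (Jmat Y Vs x)⁻¹))
        (Pc Y Vs x) := by
  have hd := hx.2.1
  let e : (Fin n → ℝ) ≃L[ℝ] (Fin n → ℝ) := ContinuousLinearEquiv.equivOfInverse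
    (LinearMap.toContinuousLinearMap (Matrix.toLin' (Jmat Y Vs x)))
    (LinearMap.toContinuousLinearMap (Matrix.toLin' (Jmat Y Vs x)⁻¹))
    (fun v => by simp [Matrix.mulVec_mulVec, Matrix.nonsing_inv_mul _ hd])
    (fun v => by simp [Matrix.mulVec_mulVec, Matrix.mul_nonsing_inv _ hd])
  have hf' : HasFDerivAt (Pc Y Vs) (e : (Fin n → ℝ) →L[ℝ] (Fin n → ℝ)) x :=
    hasFDerivAt_Pc Y Vs x
  have hf : ContDiffAt ℝ 1 (Pc Y Vs) x := (contDiff_Pc Y Vs).contDiffAt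
  refine ⟨hf.localInverse hf' one_ne_zero, hf.localInverse_apply_image hf' one_ne_zero,
    hf.to_localInverse hf' one_ne_zero, ?_, ?_⟩
  · exact (hf.hasStrictFDerivAt' hf' one_ne_zero).eventually_right_inverse
  · exact (hf.hasStrictFDerivAt' hf' one_ne_zero).to_localInverse.hasFDerivAt

theorem coercive {n : ℕ} {Y : Matrix (Fin n) (Fin n) ℝ} (hn : 1 ≤ n) (hPD : Y.PosDef) :
    ∃ ε > 0, ∀ x : Fin n → ℝ, ε * ‖x‖ ^ 2 ≤ x ⬝ᵥ (Y *ᵥ x) := by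
  have : Nonempty (Fin n) := ⟨⟨0, hn⟩⟩
  have hne : (Metric.sphere (0 : Fin n → ℝ) 1).Nonempty := NormedSpace.sphere_nonempty.2 zero_le_one
  have hc : Continuous fun x : Fin n → ℝ => x ⬝ᵥ (Y *ᵥ x) := by
    simp only [Matrix.mulVec, dotProduct]; fun_prop
  obtain ⟨z, hz, hmin⟩ := (isCompact_sphere (0 : Fin n → ℝ) 1).exists_isMinOn hne hc.continuousOn
  have hz0 : z ≠ 0 := fun h => by simp [h] at hz
  refine ⟨z ⬝ᵥ (Y *ᵥ z), ?_, fun x => ?_⟩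
  · simpa using hPD.dotProduct_mulVec_pos hz0
  · by_cases hx : x = 0
    · simp [hx]
    · have hnx : ‖x‖ ≠ 0 := norm_ne_zero_iff.2 hx
      have h1 : ‖x‖⁻¹ • x ∈ Metric.sphere (0 : Fin n → ℝ) 1 := by
        simp [norm_smul, hnx]
      have h2 := hmin h1
      simp only [Set.mem_ofPred_eq, Matrix.mulVec_smul, smul_dotProduct, dotProduct_smul,
        smul_eq_mul] at h2
      have h3 : 0 < ‖x‖ ^ 2 := by positivity
      calc _ ≤ ‖x‖⁻¹ * (‖x‖⁻¹ * (x ⬝ᵥ (Y *ᵥ x))) * ‖x‖ ^ 2 := by gcongr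
        _ = _ := by field_simp

theorem bounded {n : ℕ} {Y : Matrix (Fin n) (Fin n) ℝ} (hn : 1 ≤ n) (hPD : Y.PosDef)
    (Vs : Fin n → ℝ) (C : ℝ) :
    ∃ R, ∀ x : Fin n → ℝ, -C ≤ ∑ i, Pc Y Vs x i → ‖x‖ ≤ R := by
  obtain ⟨ε, hε, h⟩ := coercive hn hPD
  set a := ∑ i, |(Y *ᵥ Vs) i| with ha
  have ha0 : 0 ≤ a := Finset.sum_nonneg fun i _ => abs_nonneg _
  refine ⟨(a + |C|) / ε + 1, fun x hx => ?_⟩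
  have h1 : ∑ i, Pc Y Vs x i = ∑ i, x i * (Y *ᵥ Vs) i - x ⬝ᵥ (Y *ᵥ x) := by
    simp only [Pc_apply, Matrix.mulVec_sub, Pi.sub_apply, mul_sub, Finset.sum_sub_distrib]
    rfl
  have h2 : ∑ i, x i * (Y *ᵥ Vs) i ≤ ‖x‖ * a := by
    rw [ha, Finset.mul_sum]
    refine Finset.sum_le_sum fun i _ => ?_
    calc _ ≤ |x i * (Y *ᵥ Vs) i| := le_abs_self _
      _ = |x i| * |(Y *ᵥ Vs) i| := abs_mul _ _
      _ ≤ _ := by gcongr; exact norm_le_pi_norm x i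
  by_contra! hc
  have h3 := h x
  have hp : 0 ≤ (a + |C|) / ε := by positivity
  have h5 : (a + |C|) / ε < ‖x‖ := by linarith
  rw [div_lt_iff₀ hε] at h5
  have h6 := le_abs_self C
  have h7 := abs_nonneg C
  nlinarith

theorem closing {n : ℕ} {Y : Matrix (Fin n) (Fin n) ℝ} (hn : 1 ≤ n) (hZ : IsZmat Y)
    (hs : ∀ i j, Y i j = Y j i) (hI : IsIrred Y) {Vs : Fin n → ℝ}
    (hInn : ∀ i, 0 ≤ (Y *ᵥ Vs) i) (hIne : Y *ᵥ Vs ≠ 0) {x u : Fin n → ℝ}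
    (hx : ∀ i, 0 ≤ x i) (hdiag : ∀ i, 0 ≤ Bm Y Vs x i i) (hu : ∀ i, 0 ≤ u i)
    (hsum : ∑ i, u i = 1) (hB : ∀ i, 0 ≤ (Bm Y Vs x *ᵥ u) i)
    (hBe : ∀ i j, (Bm Y Vs x *ᵥ u) i = (Bm Y Vs x *ᵥ u) j) :
    (∀ i, 0 < x i) ∧ (x ∈ Dset Y Vs ∨ ((∀ i, 0 < u i) ∧ ∀ i, (Bm Y Vs x *ᵥ u) i = 0)) := by
  have hz : ∀ i, x i = 0 → (Y *ᵥ Vs) i ≤ (Y *ᵥ x) i := by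
    intro i hi
    have := hdiag i
    rw [Bm_apply, hi, Matrix.mulVec_sub] at this
    simp at this
    linarith
  have hxp : ∀ i, 0 < x i := by
    refine aux_pos Y hZ hI x hx ?_ fun i hi => (hInn i).trans (hz i hi)
    by_contra! h
    apply hIne
    have h0 : x = 0 := funext h
    funext i
    have := hz i (h i)
    rw [h0] at this
    simp at this
    exact le_antisymm this (hInn i)
  have hup : ∀ i, 0 < u i := by
    refine aux_pos _ (Bm_Z hZ Vs x hx) (Bm_irr hs hI Vs x hxp) u hu ?_ fun i _ => hB i
    by_contra! h
    simp [h] at hsum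
  refine ⟨hxp, ?_⟩
  by_cases hc : (Bm Y Vs x *ᵥ u) ⟨0, hn⟩ = 0
  · exact Or.inr ⟨hup, fun i => by rw [hBe i ⟨0, hn⟩, hc]⟩
  · refine Or.inl ((mem_D_iff hn hZ hs hI Vs x).2 ⟨hxp, u, hup, fun i => ?_⟩)
    exact lt_of_le_of_ne (hB i) (fun h => hc (by rw [hBe _ i, ← h]))

theorem support {n : ℕ} {Y : Matrix (Fin n) (Fin n) ℝ} (hZ : IsZmat Y) {Vs : Fin n → ℝ}
    (hInn : ∀ i, 0 ≤ (Y *ᵥ Vs) i) {x u : Fin n → ℝ}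
    (hx : ∀ i, 0 < x i) (hu : ∀ i, 0 < u i) (hB : ∀ i, (Bm Y Vs x *ᵥ u) i = 0)
    {P : Fin n → ℝ} (hP : P ∈ convexHull ℝ (Fset Y Vs)) :
    ∑ i, u i * P i ≤ ∑ i, u i * Pc Y Vs x i := by
  have hsub : Fset Y Vs ⊆ {P | ∑ i, u i * P i ≤ ∑ i, u i * Pc Y Vs x i} := by
    rintro _ ⟨y, hy, rfl⟩
    have e := Pc_diff Y Vs x y u
    have q := quad hZ Vs x u (y - x) hx fun i => (hu i).le
    simp only [hB, zero_mul, zero_add, Finset.sum_const_zero, neg_zero] at e q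
    have : 0 ≤ ∑ i, ((y - x) i / x i) ^ 2 * x i * (u i * (Y *ᵥ Vs) i) :=
      Finset.sum_nonneg fun i _ => mul_nonneg (mul_nonneg (sq_nonneg _) (hx i).le)
        (mul_nonneg (hu i).le (hInn i))
    change ∑ i, u i * Pc Y Vs y i ≤ _
    linarith
  have hconv : Convex ℝ {P : Fin n → ℝ | ∑ i, u i * P i ≤ ∑ i, u i * Pc Y Vs x i} := by
    refine convex_halfSpace_le ⟨fun a b => ?_, fun c a => ?_⟩ _
    · simp [mul_add, Finset.sum_add_distrib]
    · simp only [Pi.smul_apply, smul_eq_mul, Finset.mul_sum]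
      exact Finset.sum_congr rfl fun i _ => by ring
  exact convexHull_min hsub hconv hP

theorem support_lt {n : ℕ} {Y : Matrix (Fin n) (Fin n) ℝ} (hn : 1 ≤ n) (hZ : IsZmat Y)
    {Vs : Fin n → ℝ}
    (hInn : ∀ i, 0 ≤ (Y *ᵥ Vs) i) {x u : Fin n → ℝ}
    (hx : ∀ i, 0 < x i) (hu : ∀ i, 0 < u i) (hB : ∀ i, (Bm Y Vs x *ᵥ u) i = 0)
    {P : Fin n → ℝ} (hP : P ∈ interior (convexHull ℝ (Fset Y Vs))) :
    ∑ i, u i * P i < ∑ i, u i * Pc Y Vs x i := by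
  have hc : Continuous fun t : ℝ => P + t • u := by fun_prop
  have h1 : ∀ᶠ t in nhds (0 : ℝ), P + t • u ∈ convexHull ℝ (Fset Y Vs) := by
    apply hc.continuousAt.eventually_mem
    simpa using mem_interior_iff_mem_nhds.1 hP
  obtain ⟨t, ht, ht0⟩ := ((h1.filter_mono nhdsWithin_le_nhds).and
    (self_mem_nhdsWithin (a := (0 : ℝ)) (s := Set.Ioi 0))).exists
  have h2 := support hZ hInn hx hu hB ht
  have ht0 : 0 < t := ht0
  have h3 : 0 < ∑ i, u i * (t * u i) :=
    Finset.sum_pos (fun i _ => mul_pos (hu i) (mul_pos ht0 (hu i))) ⟨⟨0, hn⟩, by simp⟩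
  simp only [Pi.add_apply, Pi.smul_apply, smul_eq_mul, mul_add, Finset.sum_add_distrib] at h2
  linarith

theorem T_all {n : ℕ} {Y : Matrix (Fin n) (Fin n) ℝ} (hn : 1 ≤ n) (hPD : Y.PosDef)
    (hZ : IsZmat Y) (hs : ∀ i j, Y i j = Y j i) (hI : IsIrred Y) {Vs : Fin n → ℝ}
    (hInn : ∀ i, 0 ≤ (Y *ᵥ Vs) i) (hIne : Y *ᵥ Vs ≠ 0)
    {xh : Fin n → ℝ} (hxh : xh ∈ Dset Y Vs)
    {Pt : Fin n → ℝ} (hPt : Pt ∈ interior (convexHull ℝ (Fset Y Vs))) :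
    Icc (0 : ℝ) 1 ⊆ {θ | ∃ x ∈ Dset Y Vs, Pc Y Vs x = θ • Pt + (1 - θ) • Pc Y Vs xh} := by
  have hPcont : Continuous fun θ : ℝ => θ • Pt + (1 - θ) • Pc Y Vs xh := by fun_prop
  obtain ⟨R, hR⟩ := bounded hn hPD Vs
    (∑ i, |Pt i| + ∑ i, |Pc Y Vs xh i|)
  let K : Set (((Fin n → ℝ) × (Fin n → ℝ)) × ℝ) :=
    {p | (∀ i, 0 ≤ p.1.1 i) ∧ (∀ i, 0 ≤ Bm Y Vs p.1.1 i i) ∧ (∀ i, 0 ≤ p.1.2 i) ∧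
      ∑ i, p.1.2 i = 1 ∧ (∀ i, 0 ≤ (Bm Y Vs p.1.1 *ᵥ p.1.2) i) ∧
      (∀ i j, (Bm Y Vs p.1.1 *ᵥ p.1.2) i = (Bm Y Vs p.1.1 *ᵥ p.1.2) j) ∧
      Pc Y Vs p.1.1 = p.2 • Pt + (1 - p.2) • Pc Y Vs xh ∧ p.2 ∈ Icc (0 : ℝ) 1}
  have hKclosed : IsClosed K := by
    have hB : ∀ i, Continuous fun p : ((Fin n → ℝ) × (Fin n → ℝ)) × ℝ =>
      (Bm Y Vs p.1.1 *ᵥ p.1.2) i := fun i => (cont_BmV Y Vs i).comp continuous_fst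
    have hB' : ∀ i, Continuous fun p : ((Fin n → ℝ) × (Fin n → ℝ)) × ℝ =>
      Bm Y Vs p.1.1 i i := fun i => (cont_Bm Y Vs i i).comp (by fun_prop)
    have hPc : Continuous fun p : ((Fin n → ℝ) × (Fin n → ℝ)) × ℝ => Pc Y Vs p.1.1 :=
      (contDiff_Pc Y Vs).continuous.comp (by fun_prop)
    refine IsClosed.and ?_ <| IsClosed.and ?_ <| IsClosed.and ?_ <| IsClosed.and ?_ <|
      IsClosed.and ?_ <| IsClosed.and ?_ <| IsClosed.and ?_ ?_
    · simp only [Set.setOf_forall]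
      exact isClosed_iInter fun i => isClosed_le continuous_const (by fun_prop)
    · simp only [Set.setOf_forall]
      exact isClosed_iInter fun i => isClosed_le continuous_const (hB' i)
    · simp only [Set.setOf_forall]
      exact isClosed_iInter fun i => isClosed_le continuous_const (by fun_prop)
    · exact isClosed_eq (by fun_prop) continuous_const
    · simp only [Set.setOf_forall]
      exact isClosed_iInter fun i => isClosed_le continuous_const (hB i)
    · simp only [Set.setOf_forall]
      exact isClosed_iInter fun i => isClosed_iInter fun j => isClosed_eq (hB i) (hB j)
    · exact isClosed_eq hPc (by fun_prop)
    · exact isClosed_Icc.preimage continuous_snd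
  have hKsub : K ⊆ ((Metric.closedBall 0 R) ×ˢ (Metric.closedBall 0 1)) ×ˢ Icc (0 : ℝ) 1 := by
    rintro ⟨⟨x, u⟩, θ⟩ ⟨-, -, h3, h4, -, -, h7, h8⟩
    dsimp only at h3 h4 h7 h8
    refine ⟨⟨?_, ?_⟩, h8⟩
    · rw [mem_closedBall_zero_iff]
      apply hR
      rw [h7, ← Finset.sum_add_distrib, ← Finset.sum_neg_distrib]
      refine Finset.sum_le_sum fun i _ => ?_
      simp only [Pi.add_apply, Pi.smul_apply, smul_eq_mul]
      obtain ⟨ha, hb⟩ := h8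
      have e1 : -|Pt i| ≤ θ * Pt i := by
        nlinarith [neg_abs_le (Pt i), abs_nonneg (Pt i)]
      have e2 : -|Pc Y Vs xh i| ≤ (1 - θ) * Pc Y Vs xh i := by
        nlinarith [neg_abs_le (Pc Y Vs xh i), abs_nonneg (Pc Y Vs xh i)]
      linarith
    · rw [mem_closedBall_zero_iff, pi_norm_le_iff_of_nonneg zero_le_one]
      intro i
      rw [Real.norm_of_nonneg (h3 i), ← h4]
      exact Finset.single_le_sum (fun j _ => h3 j) (Finset.mem_univ i)
  have hK : IsCompact K := (((isCompact_closedBall _ _).prod (isCompact_closedBall _ _)).prod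
    isCompact_Icc).of_isClosed_subset hKclosed hKsub
  have hTK : {θ | ∃ x ∈ Dset Y Vs, Pc Y Vs x = θ • Pt + (1 - θ) • Pc Y Vs xh} ∩ Icc (0 : ℝ) 1
      = Prod.snd '' K := by
    ext θ
    constructor
    · rintro ⟨⟨x, hx, hP⟩, hθ⟩
      obtain ⟨u, hu, h1⟩ := D_cert hn hx
      set s := ∑ i, u i with hsdef
      have hs0 : 0 < s := Finset.sum_pos (fun i _ => hu i) ⟨⟨0, hn⟩, by simp⟩
      refine ⟨((x, s⁻¹ • u), θ), ⟨fun i => (hx.1 i).le, D_diag hn hZ hx, fun i => ?_, ?_,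
        fun i => ?_, fun i j => ?_, hP, hθ⟩, rfl⟩
      · have := hu i
        simp only [Pi.smul_apply, smul_eq_mul]; positivity
      · simp only [Pi.smul_apply, smul_eq_mul, ← Finset.mul_sum]
        exact inv_mul_cancel₀ hs0.ne'
      · simp only [Matrix.mulVec_smul, Pi.smul_apply, h1, smul_eq_mul]; positivity
      · simp only [Matrix.mulVec_smul, Pi.smul_apply, h1]
    · rintro ⟨⟨⟨x, u⟩, θ⟩, ⟨h1, h2, h3, h4, h5, h6, h7, h8⟩, rfl⟩
      refine ⟨?_, h8⟩
      dsimp only at *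
      obtain ⟨hxp, hD | ⟨hup, h0⟩⟩ := closing hn hZ hs hI hInn hIne h1 h2 h3 h4 h5 h6
      · exact ⟨x, hD, h7⟩
      · rcases h8.1.eq_or_lt with h | h
        · refine ⟨xh, hxh, ?_⟩
          simp [← h]
        · exfalso
          have a1 := support_lt hn hZ hInn hxp hup h0 hPt
          have a2 := support hZ hInn hxp hup h0
            (subset_convexHull ℝ _ (show Pc Y Vs xh ∈ Fset Y Vs from ⟨xh, hxh.1, rfl⟩))
          have a3 : ∑ i, u i * Pc Y Vs x i =
              θ * ∑ i, u i * Pt i + (1 - θ) * ∑ i, u i * Pc Y Vs xh i := by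
            rw [h7, Finset.mul_sum, Finset.mul_sum, ← Finset.sum_add_distrib]
            refine Finset.sum_congr rfl fun i _ => ?_
            simp only [Pi.add_apply, Pi.smul_apply, smul_eq_mul]; ring
          have b1 := mul_lt_mul_of_pos_left a1 h
          have b2 := mul_le_mul_of_nonneg_left a2 (sub_nonneg.2 h8.2)
          linarith
  refine IsClosed.Icc_subset_of_forall_mem_nhdsWithin ?_ ⟨xh, hxh, by simp⟩ ?_
  · rw [hTK]
    exact (hK.image continuous_snd).isClosed
  · rintro θ ⟨⟨x, hx, hP⟩, -⟩
    apply mem_nhdsWithin_of_mem_nhds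
    obtain ⟨g, hg, hgc, hgr, -⟩ := local_inv hx
    have h1 : ∀ᶠ P in nhds (Pc Y Vs x), g P ∈ Dset Y Vs := by
      apply hgc.continuousAt.eventually_mem
      rw [hg]
      exact (D_open hn hZ hs hI Vs).mem_nhds hx
    rw [hP] at h1 hgr
    filter_upwards [hPcont.continuousAt.eventually h1, hPcont.continuousAt.eventually hgr]
      with t ht1 ht2
    exact ⟨_, ht1, ht2⟩

theorem stmt_15 (n : ℕ) (hn : 1 ≤ n)
    (Y : Matrix (Fin n) (Fin n) ℝ)
    (hPD : Y.PosDef)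
    (hZ : IsZmat Y)
    (hirr : IsIrred Y)
    (Vs : Fin n → ℝ) (hVs : ∀ i, 0 < Vs i)
    (hInn : ∀ i, 0 ≤ (Y *ᵥ Vs) i) (hIne : Y *ᵥ Vs ≠ 0)
    (xh : Fin n → ℝ) (hxh : xh ∈ Dset Y Vs)
    (Pt : Fin n → ℝ) (hPt : Pt ∈ interior (convexHull ℝ (Fset Y Vs))) :
    ∃ γ : ℝ → Fin n → ℝ,
      PathProp Y Vs (Pc Y Vs xh) Pt xh γ ∧
      (∀ θ ∈ Icc (0 : ℝ) 1, Pc Y Vs (γ θ) = θ • Pt + (1 - θ) • Pc Y Vs xh) ∧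
      (∀ γ' : ℝ → Fin n → ℝ, PathProp Y Vs (Pc Y Vs xh) Pt xh γ' →
        ∀ θ ∈ Icc (0 : ℝ) 1, γ' θ = γ θ) := by
  have hs : ∀ i j, Y i j = Y j i := fun i j => by
    have := hPD.isHermitian.apply i j
    simpa using this.symm
  have hT := T_all hn hPD hZ hs hirr hInn hIne hxh hPt
  set Q : ℝ → Fin n → ℝ := fun θ => θ • Pt + (1 - θ) • Pc Y Vs xh with hQ
  have hPcont : Continuous Q := by rw [hQ]; fun_prop
  have hQd : ∀ θ, HasDerivAt Q (Pt - Pc Y Vs xh) θ := by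
    intro θ
    have h1 := ((hasDerivAt_id θ).smul_const Pt).add
      (((hasDerivAt_id θ).const_sub 1).smul_const (Pc Y Vs xh))
    refine h1.congr_deriv ?_
    simp [sub_eq_add_neg]
  have hQc : ContDiff ℝ 1 Q := by rw [hQ]; fun_prop
  classical
  let γ : ℝ → Fin n → ℝ := fun θ => if h : ∃ x ∈ Dset Y Vs, Pc Y Vs x = Q θ
    then h.choose else 0
  have hγ : ∀ θ, (∃ x ∈ Dset Y Vs, Pc Y Vs x = Q θ) → γ θ ∈ Dset Y Vs ∧ Pc Y Vs (γ θ) = Q θ := by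
    intro θ h
    simp only [γ, dif_pos h]
    exact h.choose_spec
  have huniq : ∀ θ x, x ∈ Dset Y Vs → Pc Y Vs x = Q θ → x = γ θ := by
    intro θ x hx hP
    obtain ⟨h1, h2⟩ := hγ θ ⟨x, hx, hP⟩
    exact D_inj hn hZ hInn hx h1 (hP.trans h2.symm)
  have hloc : ∀ θ ∈ Icc (0 : ℝ) 1, ContDiffAt ℝ 1 γ θ ∧
      HasDerivAt γ ((Jmat Y Vs (γ θ))⁻¹ *ᵥ (Pt - Pc Y Vs xh)) θ := by
    intro θ hθ
    obtain ⟨hx, hP⟩ := hγ θ (hT hθ)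
    obtain ⟨g, hg, hgc, hgr, hgd⟩ := local_inv hx
    have h1 : ∀ᶠ P in nhds (Pc Y Vs (γ θ)), g P ∈ Dset Y Vs := by
      apply hgc.continuousAt.eventually_mem
      rw [hg]
      exact (D_open hn hZ hs hirr Vs).mem_nhds hx
    rw [hP] at h1 hgr hgc hgd
    have heq : γ =ᶠ[nhds θ] g ∘ Q := by
      filter_upwards [hPcont.continuousAt.eventually h1, hPcont.continuousAt.eventually hgr]
        with t ht1 ht2
      exact (huniq t _ ht1 ht2).symm
    refine ⟨(hgc.comp θ hQc.contDiffAt).congr_of_eventuallyEq heq, ?_⟩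
    have h5 := hgd.comp_hasDerivAt θ (hQd θ)
    exact h5.congr_of_eventuallyEq heq
  refine ⟨γ, ⟨fun θ hθ => (hloc θ hθ).1.contDiffWithinAt, ?_, fun θ hθ => (hγ θ (hT hθ)).1,
    fun θ hθ => (hloc θ hθ).2.hasDerivWithinAt⟩, fun θ hθ => (hγ θ (hT hθ)).2, ?_⟩
  · exact (huniq 0 xh hxh (by simp [hQ])).symm
  · rintro γ' ⟨-, h0, hD, hd⟩ θ hθ
    refine huniq θ _ (hD θ hθ) ?_
    have key : ∀ t ∈ Icc (0 : ℝ) 1,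
        HasDerivWithinAt (fun t => Pc Y Vs (γ' t) - Q t) 0 (Icc 0 1) t := by
      intro t ht
      have h1 := (hasFDerivAt_Pc Y Vs (γ' t)).comp_hasDerivWithinAt t (hd t ht)
      have h2 := h1.sub (hQd t).hasDerivWithinAt
      refine h2.congr_deriv ?_
      simp [Matrix.mulVec_mulVec, Matrix.mul_nonsing_inv _ (hD t ht).2.1]
    have hc := constant_of_has_deriv_right_zero (f := fun t => Pc Y Vs (γ' t) - Q t)
      (a := 0) (b := 1) (fun t ht => (key t ht).continuousWithinAt)
      (fun t ht => ((key t (Ico_subset_Icc_self ht)).mono_of_mem_nhdsWithin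
        (Icc_mem_nhdsGE_of_mem ht))) θ hθ
    simp only [h0] at hc
    have : Q 0 = Pc Y Vs xh := by simp [hQ]
    rw [this, sub_self] at hc
    exact sub_eq_zero.1 hc
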